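/- Let c > 0 be a fixed constant. Then there exists a constant t > 0 (depending only on c) such that almost surely the Erdős–Rényi random graph G(n, c/n) contains no vertex set of size k with 4 ≤ k ≤ t·n spanning at least 2k−3 edges. (That is, apart from single edges and triangles, there are no sub-linear-size induced subgraphs with enough edges to be rigid blocks.) -/

import Mathlib

open MeasureTheory Filter

noncomputable instance {n : ℕ} : MeasurableSpace (SimpleGraph (Fin n)) := ⊤

/-- The Bernoulli(p) measure on `Bool`. -/
noncomputable def bernoulliMeasure (p : ℝ) : Measure Bool :=
  ENNReal.ofReal p • Measure.dirac true + ENNReal.ofReal (1 - p) • Measure.dirac false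

/-- The Erdős–Rényi measure on simple graphs on `Fin n`: the pushforward to
`SimpleGraph (Fin n)` of the product Bernoulli(p) measure over unordered pairs
of distinct vertices. -/
noncomputable def erdosRenyi (n : ℕ) (p : ℝ) : Measure (SimpleGraph (Fin n)) :=
  Measure.map
    (fun f : ({e : Sym2 (Fin n) // ¬ e.IsDiag} → Bool) =>
      SimpleGraph.fromEdgeSet {e : Sym2 (Fin n) | ∃ h : ¬ e.IsDiag, f ⟨e, h⟩ = true})
    (Measure.pi fun _ => bernoulliMeasure p)

/-- The edges of `G` spanned by the vertex set `S`. -/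
def spannedEdges {n : ℕ} (G : SimpleGraph (Fin n)) (S : Finset (Fin n)) : Set (Sym2 (Fin n)) :=
  {e | e ∈ G.edgeSet ∧ ∀ v ∈ e, v ∈ S}

/-- `H` is a (2,3)-tight (Laman) graph on the vertex set `S`: all edges of `H` lie
inside `S`, every subset `T ⊆ S` with `|T| ≥ 2` spans at most `2|T| - 3` edges, and
`H` has exactly `2|S| - 3` edges. -/
def IsTightOn {n : ℕ} (H : SimpleGraph (Fin n)) (S : Finset (Fin n)) : Prop :=
  (∀ e ∈ H.edgeSet, ∀ v ∈ e, v ∈ S) ∧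
  (∀ T : Finset (Fin n), T ⊆ S → 2 ≤ T.card →
    (spannedEdges H T).ncard ≤ 2 * T.card - 3) ∧
  H.edgeSet.ncard = 2 * S.card - 3

/-- The induced subgraph `G[S]` is rigid: it contains a spanning (2,3)-tight subgraph. -/
def IsRigidOn {n : ℕ} (G : SimpleGraph (Fin n)) (S : Finset (Fin n)) : Prop :=
  ∃ H ≤ G, IsTightOn H S

/-- `S` is a rigid component of `G`: `|S| ≥ 2`, `G[S]` is rigid, and `S` is
inclusion-wise maximal with this property. -/
def IsRigidComponent {n : ℕ} (G : SimpleGraph (Fin n)) (S : Finset (Fin n)) : Prop :=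
  2 ≤ S.card ∧ IsRigidOn G S ∧
  ∀ S' : Finset (Fin n), S ⊆ S' → IsRigidOn G S' → S' = S

theorem isProbabilityMeasure_bernoulliMeasure {p : ℝ} (h0 : 0 ≤ p) (h1 : p ≤ 1) :
    IsProbabilityMeasure (bernoulliMeasure p) := by
  constructor
  simp only [bernoulliMeasure, Measure.add_apply, Measure.smul_apply, measure_univ, smul_eq_mul,
    mul_one]
  rw [← ENNReal.ofReal_add h0 (by linarith)]
  simp

theorem bernoulliMeasure_true (p : ℝ) : bernoulliMeasure p {true} = ENNReal.ofReal p := by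
  simp [bernoulliMeasure]

theorem pi_bernoulliMeasure_forall_true {ι : Type*} [Fintype ι] {p : ℝ}
    (h0 : 0 ≤ p) (h1 : p ≤ 1) (F : Finset ι) :
    Measure.pi (fun _ : ι => bernoulliMeasure p) {f | ∀ e ∈ F, f e = true}
      = ENNReal.ofReal (p ^ F.card) := by
  classical
  have := isProbabilityMeasure_bernoulliMeasure h0 h1
  have hset : {f : ι → Bool | ∀ e ∈ F, f e = true}
      = Set.univ.pi fun e => if e ∈ F then {true} else Set.univ := by
    ext f
    simp only [Set.mem_ofPred_eq, Set.mem_pi, Set.mem_univ, true_imp_iff]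
    refine forall_congr' fun e => ?_
    by_cases he : e ∈ F <;> simp [he]
  rw [hset, Measure.pi_pi, ENNReal.ofReal_pow h0, ← Finset.prod_const,
    ← Finset.prod_subset (Finset.subset_univ F)]
  · exact Finset.prod_congr rfl fun e he => by simp [he, bernoulliMeasure_true]
  · intro e _ he
    rw [if_neg he, measure_univ]

/-- The potential edges with both endpoints in `S`. -/
noncomputable def potentialEdges {n : ℕ} (S : Finset (Fin n)) :
    Finset {e : Sym2 (Fin n) // ¬ e.IsDiag} :=
  Finset.univ.filter fun e => ∀ v ∈ e.1, v ∈ S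

theorem card_potentialEdges_le {n : ℕ} (S : Finset (Fin n)) :
    (potentialEdges S).card ≤ S.card ^ 2 := by
  classical
  calc (potentialEdges S).card ≤ S.sym2.card := by
        refine Finset.card_le_card_of_injOn Subtype.val ?_ Subtype.val_injective.injOn
        intro e he
        have he' : ∀ v ∈ e.1, v ∈ S := by simpa [potentialEdges] using he
        exact Finset.mem_sym2_iff.mpr he'
    _ = (S.card + 1).choose 2 := Finset.card_sym2 S
    _ ≤ S.card ^ 2 := by
        rw [Nat.choose_two_right, Nat.add_sub_cancel]
        apply Nat.div_le_of_le_mul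
        nlinarith [Nat.le_mul_self S.card]

theorem spannedEdges_fromEdgeSet {n : ℕ} (f : {e : Sym2 (Fin n) // ¬ e.IsDiag} → Bool)
    (S : Finset (Fin n)) :
    (spannedEdges (SimpleGraph.fromEdgeSet
        {e : Sym2 (Fin n) | ∃ h : ¬ e.IsDiag, f ⟨e, h⟩ = true}) S).ncard
      = ((potentialEdges S).filter fun e => f e = true).card := by
  rw [← Set.ncard_coe_finset, ← Set.ncard_image_of_injective _ Subtype.val_injective]
  congr 1
  ext e
  simp only [spannedEdges, SimpleGraph.edgeSet_fromEdgeSet, Set.mem_ofPred_eq, Set.mem_image,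
    Set.mem_sdiff, potentialEdges, Finset.coe_filter, Finset.mem_filter, Finset.mem_univ, true_and,
    Subtype.exists, exists_and_right, exists_eq_right]
  constructor
  · rintro ⟨⟨⟨h, hf⟩, -⟩, hS⟩
    exact ⟨h, hS, hf⟩
  · rintro ⟨h, hS, hf⟩
    exact ⟨⟨⟨h, hf⟩, h⟩, hS⟩

/-- First moment bound for the existence of a set of `k` vertices spanning `m` edges. -/
theorem pi_bernoulliMeasure_exists_dense_le {n : ℕ} {p : ℝ} (h0 : 0 ≤ p) (h1 : p ≤ 1)
    (k m : ℕ) :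
    Measure.pi (fun _ : {e : Sym2 (Fin n) // ¬ e.IsDiag} => bernoulliMeasure p)
      {f | ∃ S : Finset (Fin n), S.card = k ∧
        m ≤ ((potentialEdges S).filter fun e => f e = true).card}
      ≤ ENNReal.ofReal (n.choose k * (k ^ 2).choose m * p ^ m) := by
  classical
  set μ := Measure.pi (fun _ : {e : Sym2 (Fin n) // ¬ e.IsDiag} => bernoulliMeasure p)
  have hsub : {f : {e : Sym2 (Fin n) // ¬ e.IsDiag} → Bool | ∃ S : Finset (Fin n), S.card = k ∧
        m ≤ ((potentialEdges S).filter fun e => f e = true).card}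
      ⊆ ⋃ S ∈ Finset.powersetCard k (Finset.univ : Finset (Fin n)),
          ⋃ F ∈ Finset.powersetCard m (potentialEdges S), {f | ∀ e ∈ F, f e = true} := by
    rintro f ⟨S, hS, hm⟩
    obtain ⟨F, hF, hFm⟩ := Finset.exists_subset_card_eq hm
    simp only [Set.mem_iUnion, Finset.mem_powersetCard]
    refine ⟨S, ⟨Finset.subset_univ _, hS⟩, F, ⟨hF.trans (Finset.filter_subset _ _), hFm⟩, ?_⟩
    exact fun e he => (Finset.mem_filter.mp (hF he)).2
  calc _ ≤ _ := measure_mono hsub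
    _ ≤ ∑ S ∈ Finset.powersetCard k (Finset.univ : Finset (Fin n)),
          ∑ F ∈ Finset.powersetCard m (potentialEdges S), μ {f | ∀ e ∈ F, f e = true} :=
        (measure_biUnion_finset_le _ _).trans
          (Finset.sum_le_sum fun S _ => measure_biUnion_finset_le _ _)
    _ ≤ ∑ S ∈ Finset.powersetCard k (Finset.univ : Finset (Fin n)),
          ENNReal.ofReal ((k ^ 2).choose m * p ^ m) := by
        refine Finset.sum_le_sum fun S hS => ?_
        have hF : ∀ F ∈ Finset.powersetCard m (potentialEdges S),
            μ {f | ∀ e ∈ F, f e = true} = ENNReal.ofReal (p ^ m) := fun F hF => by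
          rw [pi_bernoulliMeasure_forall_true h0 h1, (Finset.mem_powersetCard.mp hF).2]
        rw [Finset.sum_congr rfl hF, Finset.sum_const, Finset.card_powersetCard,
          ← ENNReal.ofReal_nsmul, nsmul_eq_mul]
        have hcard := card_potentialEdges_le S
        rw [(Finset.mem_powersetCard.mp hS).2] at hcard
        gcongr
    _ = _ := by
        rw [Finset.sum_const, Finset.card_powersetCard, ← ENNReal.ofReal_nsmul, nsmul_eq_mul,
          Finset.card_univ, Fintype.card_fin, mul_assoc]

theorem pow_self_le_exp_mul_factorial (k : ℕ) :
    (k : ℝ) ^ k ≤ Real.exp 1 ^ k * k.factorial := by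
  have h := Real.pow_div_factorial_le_exp (k : ℝ) (Nat.cast_nonneg k) k
  rw [div_le_iff₀ (by positivity)] at h
  rwa [← Real.exp_nat_mul, mul_one]

theorem choose_le_exp_mul_div_pow (n k : ℕ) :
    (n.choose k : ℝ) ≤ (Real.exp 1 * n / k) ^ k := by
  rcases Nat.eq_zero_or_pos k with rfl | hk
  · simp
  have hk' : (0 : ℝ) < k := by exact_mod_cast hk
  refine (Nat.choose_le_pow_div (α := ℝ) k n).trans ?_
  rw [div_pow, mul_pow, div_le_div_iff₀ (by positivity) (by positivity)]
  calc (n : ℝ) ^ k * (k : ℝ) ^ k ≤ (n : ℝ) ^ k * (Real.exp 1 ^ k * k.factorial) := by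
        gcongr
        exact pow_self_le_exp_mul_factorial k
    _ = _ := by ring

theorem expected_dense_sets_le {c B : ℝ} (hc : 0 < c) (hB1 : 1 ≤ B) (hB : Real.exp 1 * c ≤ B)
    {n : ℕ} (hn : 0 < n) (j : ℕ) :
    (n.choose (j + 4) : ℝ) * ((j + 4) ^ 2).choose (2 * j + 5) * (c / n) ^ (2 * j + 5)
      ≤ (Real.exp 1 * B ^ 2) ^ (j + 4) * (((j + 4 : ℕ) : ℝ) / n) ^ (j + 1) := by
  have hn' : (0 : ℝ) < n := by exact_mod_cast hn
  set k : ℝ := ((j + 4 : ℕ) : ℝ) with hk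
  have hkpos : 0 < k := by rw [hk]; positivity
  have hkm : k ≤ ((2 * j + 5 : ℕ) : ℝ) := by
    rw [hk]; exact_mod_cast (by omega : j + 4 ≤ 2 * j + 5)
  have h1 : (n.choose (j + 4) : ℝ) ≤ (Real.exp 1 * n / k) ^ (j + 4) :=
    choose_le_exp_mul_div_pow n (j + 4)
  have h2 : (((j + 4) ^ 2).choose (2 * j + 5) : ℝ) ≤ (Real.exp 1 * k) ^ (2 * j + 5) := by
    refine (choose_le_exp_mul_div_pow _ _).trans ?_
    gcongr
    rw [div_le_iff₀ (by positivity), Nat.cast_pow, ← hk, mul_assoc, pow_two]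
    gcongr
  calc _ ≤ (Real.exp 1 * n / k) ^ (j + 4) * (Real.exp 1 * k) ^ (2 * j + 5)
          * (c / n) ^ (2 * j + 5) := by gcongr
    _ = Real.exp 1 ^ (j + 4) * (Real.exp 1 * c) ^ (2 * j + 5) * (k / n) ^ (j + 1) := by
        rw [show 2 * j + 5 = (j + 4) + (j + 1) by ring]
        simp only [mul_pow, div_pow, pow_add _ (j + 4) (j + 1)]
        field_simp
    _ ≤ Real.exp 1 ^ (j + 4) * B ^ (2 * (j + 4)) * (k / n) ^ (j + 1) := by
        gcongr
        exact (pow_le_pow_left₀ (by positivity) hB _).trans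
          (pow_le_pow_right₀ hB1 (by omega))
    _ = _ := by rw [mul_pow, pow_mul]

theorem expected_dense_sets_le_geometric {c B : ℝ} (hc : 0 < c) (hB1 : 1 ≤ B)
    (hB : Real.exp 1 * c ≤ B) {n : ℕ} (hn : 0 < n) (j : ℕ)
    (hj : ((j + 4 : ℕ) : ℝ) ≤ 1 / (4 * (Real.exp 1 * B ^ 2)) * n) :
    (n.choose (j + 4) : ℝ) * ((j + 4) ^ 2).choose (2 * j + 5) * (c / n) ^ (2 * j + 5)
      ≤ 4 * (Real.exp 1 * B ^ 2) ^ 4 / n * (1 / 2) ^ j := by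
  refine (expected_dense_sets_le hc hB1 hB hn j).trans ?_
  have hn' : (0 : ℝ) < n := by exact_mod_cast hn
  set A := Real.exp 1 * B ^ 2 with hA
  have hApos : 0 < A := by positivity
  have hx : A * (((j + 4 : ℕ) : ℝ) / n) ≤ 1 / 4 := by
    rw [← div_le_iff₀ hn'] at hj
    calc _ ≤ A * (1 / (4 * A)) := by gcongr
      _ = 1 / 4 := by field_simp
  have hk : ((j + 4 : ℕ) : ℝ) ≤ 4 * 2 ^ j := by
    have : j < 2 ^ j := Nat.lt_two_pow_self
    exact_mod_cast (by omega : j + 4 ≤ 4 * 2 ^ j)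
  calc A ^ (j + 4) * (((j + 4 : ℕ) : ℝ) / n) ^ (j + 1)
      = A ^ 4 * (((j + 4 : ℕ) : ℝ) / n) * (A * (((j + 4 : ℕ) : ℝ) / n)) ^ j := by ring
    _ ≤ A ^ 4 * (4 * 2 ^ j / n) * (1 / 4) ^ j := by gcongr
    _ = 4 * A ^ 4 / n * (2 ^ j * (1 / 4) ^ j) := by ring
    _ = _ := by rw [← mul_pow]; norm_num

/-- For a fixed constant `c > 0`, there is a constant `t > 0` such that almost surely
`G(n, c/n)` contains no vertex set of size `k` with `4 ≤ k ≤ t·n` spanning at least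
`2k - 3` edges. -/
theorem no_sublinear_dense_blocks (c : ℝ) (hc : 0 < c) :
    ∃ t : ℝ, 0 < t ∧
      Tendsto (fun n : ℕ =>
        erdosRenyi n (c / n)
          {G | ¬ ∃ S : Finset (Fin n), 4 ≤ S.card ∧ (S.card : ℝ) ≤ t * n ∧
            2 * S.card - 3 ≤ (spannedEdges G S).ncard})
        atTop (nhds 1) := by
  set B : ℝ := max 1 (Real.exp 1 * c) with hBdef
  have hB1 : 1 ≤ B := le_max_left _ _
  have hB : Real.exp 1 * c ≤ B := le_max_right _ _
  set A : ℝ := Real.exp 1 * B ^ 2 with hA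
  have hApos : 0 < A := by positivity
  refine ⟨1 / (4 * A), by positivity, ?_⟩
  have hlim : Tendsto (fun n : ℕ => 1 - ENNReal.ofReal (8 * A ^ 4 / n)) atTop (nhds 1) := by
    have h := ENNReal.tendsto_ofReal (tendsto_const_div_atTop_nhds_zero_nat (8 * A ^ 4))
    simpa using ENNReal.Tendsto.sub tendsto_const_nhds h (Or.inl ENNReal.one_ne_top)
  have hev : ∀ᶠ n : ℕ in atTop, 0 < n ∧ c ≤ n :=
    (eventually_gt_atTop 0).and (tendsto_natCast_atTop_atTop.eventually_ge_atTop c)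
  have hmeas : ∀ n : ℕ, Measurable fun f : ({e : Sym2 (Fin n) // ¬ e.IsDiag} → Bool) =>
      SimpleGraph.fromEdgeSet {e : Sym2 (Fin n) | ∃ h : ¬ e.IsDiag, f ⟨e, h⟩ = true} :=
    fun n => Measurable.of_discrete
  have hprob : ∀ n : ℕ, 0 < n ∧ c ≤ n → IsProbabilityMeasure (erdosRenyi n (c / n)) := by
    rintro n ⟨hn, hcn⟩
    have := isProbabilityMeasure_bernoulliMeasure (p := c / n) (by positivity)
      (div_le_one_of_le₀ hcn (Nat.cast_nonneg n))
    exact Measure.isProbabilityMeasure_map (hmeas n).aemeasurable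
  refine tendsto_of_tendsto_of_tendsto_of_le_of_le' hlim tendsto_const_nhds ?_ ?_
  · filter_upwards [hev] with n hn
    have := hprob n hn
    obtain ⟨hn, hcn⟩ := hn
    have h0 : 0 ≤ c / n := by positivity
    have h1 : c / n ≤ 1 := div_le_one_of_le₀ hcn (Nat.cast_nonneg n)
    rw [← Set.compl_ofPred, prob_compl_eq_one_sub MeasurableSpace.measurableSet_top]
    refine tsub_le_tsub_left ?_ 1
    rw [erdosRenyi, Measure.map_apply (hmeas n) MeasurableSpace.measurableSet_top]
    set J := (Finset.range n).filter fun j => ((j + 4 : ℕ) : ℝ) ≤ 1 / (4 * A) * n with hJ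
    refine (measure_mono (t := ⋃ j ∈ J, {f | ∃ S : Finset (Fin n), S.card = j + 4 ∧
      2 * j + 5 ≤ ((potentialEdges S).filter fun e => f e = true).card}) ?_).trans ?_
    · rintro f ⟨S, hS4, hSt, hS⟩
      rw [spannedEdges_fromEdgeSet] at hS
      obtain ⟨j, hj⟩ := Nat.exists_eq_add_of_le' hS4
      have hSn : S.card ≤ n := by simpa using S.card_le_univ
      simp only [Set.mem_iUnion]
      refine ⟨j, ?_, S, hj, by omega⟩
      rw [hJ, Finset.mem_filter, Finset.mem_range, ← hj]
      exact ⟨by omega, hSt⟩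
    · refine (measure_biUnion_finset_le _ _).trans ?_
      calc _ ≤ ∑ j ∈ J, ENNReal.ofReal (4 * A ^ 4 / n * (1 / 2) ^ j) := by
            refine Finset.sum_le_sum fun j hj => ?_
            exact (pi_bernoulliMeasure_exists_dense_le h0 h1 _ _).trans
              (ENNReal.ofReal_le_ofReal (expected_dense_sets_le_geometric hc hB1 hB hn j
                (Finset.mem_filter.mp hj).2))
        _ ≤ ∑ j ∈ Finset.range n, ENNReal.ofReal (4 * A ^ 4 / n * (1 / 2) ^ j) :=
            Finset.sum_le_sum_of_subset (Finset.filter_subset _ _)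
        _ = ENNReal.ofReal (4 * A ^ 4 / n * ∑ j ∈ Finset.range n, (1 / 2) ^ j) := by
            rw [Finset.mul_sum, ENNReal.ofReal_sum_of_nonneg fun j _ => by positivity]
        _ ≤ ENNReal.ofReal (4 * A ^ 4 / n * 2) := by
            gcongr
            exact sum_geometric_two_le n
        _ = _ := by congr 1; ring
  · filter_upwards [hev] with n hn
    have := hprob n hn
    exact prob_le_one
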